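/- arXiv:1706.09389 — 2 statements merged into one kernel-verified Lean document; each statement's English description precedes it below -/
import Mathlib

section
/- For all 3 ≤ m ≤ n, there exists a set of at most ⌈m/2⌉ clues on the m × n board that defines a Numbrix puzzle (i.e., is consistent with exactly one solution). -/
/-- Two cells of an `m × n` board are adjacent if they agree in one coordinate
and differ by exactly 1 in the other. -/
def Adj {m n : ℕ} (a b : Fin m × Fin n) : Prop :=
  (a.1 = b.1 ∧ (a.2.val + 1 = b.2.val ∨ b.2.val + 1 = a.2.val)) ∨
  (a.2 = b.2 ∧ (a.1.val + 1 = b.1.val ∨ b.1.val + 1 = a.1.val))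

/-- A Numbrix solution on an `m × n` board: a bijection onto `{1, …, m*n}`
(equivalently, an injective map with values in `[1, m*n]`) such that cells
carrying consecutive values are adjacent. -/
def IsNumbrix {m n : ℕ} (f : Fin m × Fin n → ℕ) : Prop :=
  (∀ c, 1 ≤ f c ∧ f c ≤ m * n) ∧ Function.Injective f ∧
    ∀ c c', f c' = f c + 1 → Adj c c'

/-- `F r c` is the value in row `r` and column `c` of a Numbrix solution on an `m × n` board. -/
structure IsLabelling (m n : ℕ) (F : ℕ → ℕ → ℕ) : Prop where
  bound : ∀ {r c}, r < m → c < n → 1 ≤ F r c ∧ F r c ≤ m * n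
  inj : ∀ {r c r' c'}, r < m → c < n → r' < m → c' < n → F r c = F r' c' → r = r' ∧ c = c'
  surj : ∀ {t}, 1 ≤ t → t ≤ m * n → ∃ r c, r < m ∧ c < n ∧ F r c = t
  step : ∀ {r c r' c'}, r < m → c < n → r' < m → c' < n → F r' c' = F r c + 1 →
    (r = r' ∧ (c + 1 = c' ∨ c' + 1 = c)) ∨ (c = c' ∧ (r + 1 = r' ∨ r' + 1 = r))

namespace IsLabelling

variable {m n : ℕ} {F : ℕ → ℕ → ℕ}

theorem dist_le_of_eq_add (h : IsLabelling m n F) {r c : ℕ} (hr : r < m) (hc : c < n) (d : ℕ) :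
    ∀ {r' c' : ℕ}, r' < m → c' < n → F r' c' = F r c + d →
      (r - r') + (r' - r) + (c - c') + (c' - c) ≤ d := by
  induction d with
  | zero =>
    intro r' c' hr' hc' e
    obtain ⟨rfl, rfl⟩ := h.inj hr' hc' hr hc (by simpa using e)
    omega
  | succ d ih =>
    intro r' c' hr' hc' e
    have b := h.bound hr' hc'
    have b' := h.bound hr hc
    obtain ⟨x, y, hx, hy, exy⟩ := h.surj (t := F r c + d) (by omega) (by omega)
    have := ih hx hy exy
    have := h.step hx hy hr' hc' (by omega)
    omega

/-- The difference of two values is at least the Manhattan distance of their cells. -/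
theorem dist_le (h : IsLabelling m n F) {r c r' c' : ℕ} (hr : r < m) (hc : c < n)
    (hr' : r' < m) (hc' : c' < n) (e : F r c ≤ F r' c') :
    F r c + ((r - r') + (r' - r) + (c - c') + (c' - c)) ≤ F r' c' := by
  have := h.dist_le_of_eq_add hr hc (F r' c' - F r c) hr' hc' (by omega)
  omega

/-- If the two ends of a row carry values differing by `n - 1`, the row carries exactly the
values in between. -/
theorem row_filled (h : IsLabelling m n F) {r s c : ℕ} (hr : r < m) (hc : c < n)
    (e : (F r 0 = s ∧ F r (n - 1) = s + n - 1) ∨ (F r 0 = s + n - 1 ∧ F r (n - 1) = s)) :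
    s ≤ F r c ∧ F r c ≤ s + n - 1 := by
  have b := h.bound hr (show 0 < n by omega)
  have b' := h.bound hr (show n - 1 < n by omega)
  rcases e with ⟨e, e'⟩ | ⟨e, e'⟩
  · obtain ⟨x, y, hx, hy, exy⟩ := h.surj (t := s + c) (by omega) (by omega)
    have := h.dist_le hr (show 0 < n by omega) hx hy (by omega)
    have := h.dist_le hx hy hr (show n - 1 < n by omega) (by omega)
    obtain rfl : x = r := by omega
    obtain rfl : y = c := by omega
    omega
  · obtain ⟨x, y, hx, hy, exy⟩ := h.surj (t := s + n - 1 - c) (by omega) (by omega)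
    have := h.dist_le hx hy hr (show 0 < n by omega) (by omega)
    have := h.dist_le hr (show n - 1 < n by omega) hx hy (by omega)
    obtain rfl : x = r := by omega
    obtain rfl : y = c := by omega
    omega

/-- The path cannot change sides of a row without visiting it. -/
theorem same_side_of_eq_add (h : IsLabelling m n F) {r lo hi : ℕ} (hr : r < m)
    (hrow : ∀ c < n, F r c < lo ∨ hi < F r c) {x y : ℕ} (hx : x < m) (hy : y < n)
    (hlo : lo ≤ F x y) (d : ℕ) :
    ∀ {x' y' : ℕ}, x' < m → y' < n → F x' y' ≤ hi → F x' y' = F x y + d →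
      (x < r ↔ x' < r) := by
  induction d with
  | zero =>
    intro x' y' hx' hy' hhi e
    obtain ⟨rfl, rfl⟩ := h.inj hx' hy' hx hy (by simpa using e)
    rfl
  | succ d ih =>
    intro x' y' hx' hy' hhi e
    have b := h.bound hx' hy'
    have b' := h.bound hx hy
    obtain ⟨u, v, hu, hv, euv⟩ := h.surj (t := F x y + d) (by omega) (by omega)
    rw [ih hu hv (by omega) euv]
    have hs := h.step hu hv hx' hy' (by omega)
    have hur : u ≠ r := by
      rintro rfl
      have := hrow v hv
      omega
    have hxr : x' ≠ r := by
      rintro rfl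
      have := hrow y' hy'
      omega
    omega

theorem same_side (h : IsLabelling m n F) {r lo hi : ℕ} (hr : r < m)
    (hrow : ∀ c < n, F r c < lo ∨ hi < F r c) {x y x' y' : ℕ} (hx : x < m) (hy : y < n)
    (hx' : x' < m) (hy' : y' < n) (hlo : lo ≤ F x y) (hlo' : lo ≤ F x' y') (hhi : F x y ≤ hi)
    (hhi' : F x' y' ≤ hi) : x < r ↔ x' < r := by
  rcases le_total (F x y) (F x' y') with e | e
  · exact h.same_side_of_eq_add hr hrow hx hy hlo (F x' y' - F x y) hx' hy' hhi' (by omega)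
  · exact (h.same_side_of_eq_add hr hrow hx' hy' hlo' (F x y - F x' y') hx hy hhi
      (by omega)).symm

/-- Counting: if rows `a, …, b - 1` only carry values in `[lo, hi]`, there is room for them. -/
theorem card_rows_le (h : IsLabelling m n F) {a b lo hi : ℕ} (hb : b ≤ m)
    (hF : ∀ r c, a ≤ r → r < b → c < n → lo ≤ F r c ∧ F r c ≤ hi) :
    (b - a) * n ≤ hi + 1 - lo := by
  have := Finset.card_le_card_of_injOn (s := Finset.Ico a b ×ˢ Finset.range n)
    (t := Finset.Icc lo hi) (fun p => F p.1 p.2) ?_ ?_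
  · simpa using this
  · rintro ⟨r, c⟩ hp
    simp only [Finset.coe_product, Set.mem_prod, Finset.mem_coe, Finset.mem_Ico,
      Finset.mem_range] at hp
    simpa using hF r c hp.1.1 hp.1.2 hp.2
  · rintro ⟨r, c⟩ hp ⟨r', c'⟩ hp' e
    simp only [Finset.coe_product, Set.mem_prod, Finset.mem_coe, Finset.mem_Ico,
      Finset.mem_range] at hp hp'
    obtain ⟨rfl, rfl⟩ := h.inj (by omega) hp.2 (by omega) hp'.2 e
    rfl

/-- A row traversed right to left and followed later by a cell below it is preceded by
everything above it. -/
theorem mul_lt_of_filled_above (h : IsLabelling m n F) {r s x y : ℕ} (hr : r < m)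
    (e : F r 0 = s + n - 1) (e' : F r (n - 1) = s) (hx : x < m) (hy : y < n) (hrx : r < x)
    (hs : s + n ≤ F x y) : r * n < s := by
  have hrow : ∀ c < n, F r c < s + n ∨ m * n < F r c := fun c hc => by
    have := h.row_filled hr hc (Or.inr ⟨e, e'⟩)
    omega
  have b := h.bound hr (show n - 1 < n by omega)
  have := h.card_rows_le (a := 0) (b := r) (lo := 1) (hi := s - 1) hr.le ?_
  · simp only [Nat.sub_zero] at this
    omega
  · intro u v _ hu hv
    refine ⟨(h.bound (by omega) hv).1, ?_⟩
    by_contra hlt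
    have hus : s + n ≤ F u v := by
      by_contra hlt'
      have hd := h.dist_le (r := u) (c := v) (r' := r) (c' := 0) (by omega) hv hr (by omega)
        (by omega)
      have hd' := h.dist_le (r := r) (c := n - 1) (r' := u) (c' := v) hr (by omega) (by omega) hv
        (by omega)
      omega
    have := h.same_side hr hrow (by omega) hv hx hy hus hs (h.bound (by omega) hv).2
      (h.bound hx hy).2
    omega

/-- A row traversed left to right and preceded by a cell above it is followed by
everything below it. -/
theorem mul_add_le_of_filled_below (h : IsLabelling m n F) {r s x y : ℕ} (hr : r < m)
    (e : F r 0 = s) (e' : F r (n - 1) = s + n - 1) (hx : x < m) (hy : y < n) (hrx : x < r)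
    (hs : F x y < s) : (m - (r + 1)) * n ≤ m * n + 1 - (s + n) := by
  have hrow : ∀ c < n, F r c < 1 ∨ s - 1 < F r c := fun c hc => by
    have := h.row_filled hr hc (Or.inl ⟨e, e'⟩)
    omega
  refine h.card_rows_le le_rfl fun u v hu hum hv => ?_
  refine ⟨?_, (h.bound hum hv).2⟩
  by_contra hlt
  have hus : F u v ≤ s - 1 := by
    by_contra hlt'
    have hd := h.dist_le (r := r) (c := 0) (r' := u) (c' := v) hr (by omega) hum hv (by omega)
    have hd' := h.dist_le (r := u) (c := v) (r' := r) (c' := n - 1) hum hv hr (by omega)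
      (by omega)
    omega
  have := h.same_side hr hrow hx hy hum hv (h.bound hx hy).1 (h.bound hum hv).1 (by omega) hus
  omega

end IsLabelling

/-- The zig-zag labelling: even rows run right to left, odd rows left to right. -/
def zigzag (n r c : ℕ) : ℕ := r * n + if r % 2 = 1 then c + 1 else n - c

/-- The row of the `i`-th clue. -/
def clueRow (m i : ℕ) : ℕ := if i % 2 = 0 ∧ 2 * i + 3 ≤ m then 2 * i + 1 else 2 * i

theorem clueRow_lt {m i : ℕ} (hi : i < (m + 1) / 2) : clueRow m i < m := by
  unfold clueRow
  split_ifs <;> omega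

/-- `F` agrees with the zig-zag labelling on all clue cells. -/
def MatchesClues (m n : ℕ) (F : ℕ → ℕ → ℕ) : Prop :=
  ∀ i < (m + 1) / 2, F (clueRow m i) 0 = zigzag n (clueRow m i) 0

namespace MatchesClues

variable {m n : ℕ} {F : ℕ → ℕ → ℕ}

theorem upper (hF : MatchesClues m n F) {k : ℕ} (hk : 4 * k + 3 ≤ m) :
    F (4 * k + 1) 0 = 4 * k * n + n + 1 := by
  have := hF (2 * k) (by omega)
  rw [show clueRow m (2 * k) = 4 * k + 1 by unfold clueRow; split_ifs <;> omega, zigzag,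
    if_pos (by omega)] at this
  rw [this]; ring

theorem lower (hF : MatchesClues m n F) {k : ℕ} (hk : 4 * k + 3 ≤ m) :
    F (4 * k + 2) 0 = 4 * k * n + 3 * n := by
  have := hF (2 * k + 1) (by omega)
  rw [show clueRow m (2 * k + 1) = 4 * k + 2 by unfold clueRow; split_ifs <;> omega, zigzag,
    if_neg (by omega)] at this
  rw [this, Nat.sub_zero]; ring

theorem last (hF : MatchesClues m n F) {k : ℕ} (hk : m = 4 * k + 1 ∨ m = 4 * k + 2) :
    F (4 * k) 0 = 4 * k * n + n := by
  have := hF (2 * k) (by omega)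
  rw [show clueRow m (2 * k) = 4 * k by unfold clueRow; split_ifs <;> omega, zigzag,
    if_neg (by omega)] at this
  rw [this, Nat.sub_zero]

end MatchesClues

namespace IsLabelling

variable {m n : ℕ} {F : ℕ → ℕ → ℕ}

theorem dist_clue (h : IsLabelling m n F) {r c : ℕ} (hr : r < m) (hc : c < n) {x t : ℕ}
    (hx : x < m) (e : F x 0 = t) :
    (F r c + c + r ≤ t + x ∧ F r c + c + x ≤ t + r) ∨
      (t + c + r ≤ F r c + x ∧ t + c + x ≤ F r c + r) := by
  rcases le_total (F r c) t with hle | hle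
  · have := h.dist_le hr hc hx (show 0 < n by omega) (by omega)
    omega
  · have := h.dist_le hx (show 0 < n by omega) hr hc (by omega)
    omega

/-- Values in the last column allowed by the distances to the clues. -/
theorem last_column_candidates (h : IsLabelling m n F) (hF : MatchesClues m n F)
    (hm : 3 ≤ m) (hn : 2 ≤ n) {r : ℕ} (hr : r < m) :
    (∃ k T, T = 4 * k * n ∧
      ((r = 4 * k ∧ (F r (n - 1) = T + 1 ∨ (m = 4 * k + 2 ∧ F r (n - 1) = T + 2 * n - 1))) ∨
      (r = 4 * k + 1 ∧
        (F r (n - 1) = T + 2 * n ∨ (4 * k + 3 ≤ m ∧ F r (n - 1) = T + 2))) ∨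
      (r = 4 * k + 2 ∧ (F r (n - 1) = T + 2 * n + 1 ∨ F r (n - 1) = T + 4 * n - 1)) ∨
      (r = 4 * k + 3 ∧ F r (n - 1) = T + 4 * n))) ∨
    (F r (n - 1) = 1 ∧ r ≤ 2) ∨ (F r (n - 1) = m * n ∧ m % 2 = 0 ∧ m ≤ r + 3) := by
  have hc : n - 1 < n := by omega
  have b := h.bound hr hc
  have D := fun {x t : ℕ} => h.dist_clue (x := x) (t := t) hr hc
  set t := F r (n - 1) with ht
  obtain ⟨k, hk1, hk2⟩ : ∃ k, 4 * k * n + 1 ≤ t ∧ t ≤ 4 * k * n + 4 * n := by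
    refine ⟨(t - 1) / (4 * n), ?_, ?_⟩
    · have := Nat.div_mul_le_self (t - 1) (4 * n)
      nlinarith [Nat.sub_add_cancel b.1]
    · have := Nat.lt_div_mul_add (a := t - 1) (show 0 < 4 * n by omega)
      have e : (t - 1) / (4 * n) * (4 * n) = 4 * ((t - 1) / (4 * n)) * n := by ring
      omega
  have hkm : 4 * k < m := by
    by_contra hlt
    have := Nat.mul_le_mul_right n (show m ≤ 4 * k by omega)
    omega
  have prev : k = 0 ∨ (1 ≤ k ∧ F (4 * k - 2) 0 + n = 4 * k * n) := by
    rcases k with _ | k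
    · exact Or.inl rfl
    · have := hF.lower (k := k) (by omega)
      refine Or.inr ⟨by omega, ?_⟩
      rw [show 4 * (k + 1) - 2 = 4 * k + 2 by omega, this]
      ring
  have Dprev : k = 0 ∨ (1 ≤ k ∧
      ((t + n + (n - 1) + r + 2 ≤ 4 * k * n + 4 * k ∧
        t + n + (n - 1) + 4 * k ≤ 4 * k * n + r + 2) ∨
      (4 * k * n + (n - 1) + r + 2 ≤ t + n + 4 * k ∧
        4 * k * n + (n - 1) + 4 * k ≤ t + n + r + 2))) := by
    rcases prev with hk | ⟨hk, e⟩
    · exact Or.inl hk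
    · have := D (show 4 * k - 2 < m by omega) rfl
      exact Or.inr ⟨hk, by omega⟩
  by_cases hone : t = 1 ∧ r ≤ 2
  · exact Or.inr (Or.inl hone)
  by_cases hmax : t = m * n ∧ m % 2 = 0 ∧ m ≤ r + 3
  · exact Or.inr (Or.inr hmax)
  suffices H :
      (r = 4 * k → t = 4 * k * n + 1 ∨ (m = 4 * k + 2 ∧ t = 4 * k * n + 2 * n - 1)) ∧
      (r = 4 * k + 1 → t = 4 * k * n + 2 * n ∨ (4 * k + 3 ≤ m ∧ t = 4 * k * n + 2)) ∧
      (r = 4 * k + 2 → t = 4 * k * n + 2 * n + 1 ∨ t = 4 * k * n + 4 * n - 1) ∧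
      (r = 4 * k + 3 → t = 4 * k * n + 4 * n) ∧ ¬ r < 4 * k ∧ ¬ 4 * k + 3 < r by
    obtain ⟨H₀, H₁, H₂, H₃, hlo, hhi⟩ := H
    refine Or.inl ⟨k, _, rfl, ?_⟩
    rcases (show r = 4 * k ∨ r = 4 * k + 1 ∨ r = 4 * k + 2 ∨ r = 4 * k + 3 by omega) with
      e | e | e | e
    · exact Or.inl ⟨e, H₀ e⟩
    · exact Or.inr (Or.inl ⟨e, H₁ e⟩)
    · exact Or.inr (Or.inr (Or.inl ⟨e, H₂ e⟩))
    · exact Or.inr (Or.inr (Or.inr ⟨e, H₃ e⟩))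
  have hk0 : k = 0 → 4 * k * n = 0 := by rintro rfl; simp
  rcases (show m = 4 * k + 1 ∨ m = 4 * k + 2 ∨ m = 4 * k + 3 ∨ m = 4 * k + 4 ∨
    (m = 4 * k + 5 ∨ m = 4 * k + 6) ∨ 4 * k + 7 ≤ m by omega) with e | e | e | e | e | e
  · have d₁ := D (by omega) (hF.last (k := k) (by omega))
    have em : m * n = 4 * k * n + n := by rw [e]; ring
    clear hF D prev
    generalize 4 * k * n = T at *
    refine ⟨fun hj => ?_, fun hj => ?_, fun hj => ?_, fun hj => ?_, fun hj => ?_, fun hj => ?_⟩ <;>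
      omega
  · have d₁ := D (by omega) (hF.last (k := k) (by omega))
    have em : m * n = 4 * k * n + 2 * n := by rw [e]; ring
    clear hF D prev
    generalize 4 * k * n = T at *
    refine ⟨fun hj => ?_, fun hj => ?_, fun hj => ?_, fun hj => ?_, fun hj => ?_, fun hj => ?_⟩ <;>
      omega
  · have d₁ := D (by omega) (hF.upper (k := k) (by omega))
    have d₂ := D (by omega) (hF.lower (k := k) (by omega))
    have em : m * n = 4 * k * n + 3 * n := by rw [e]; ring
    clear hF D prev
    generalize 4 * k * n = T at *
    refine ⟨fun hj => ?_, fun hj => ?_, fun hj => ?_, fun hj => ?_, fun hj => ?_, fun hj => ?_⟩ <;>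
      omega
  · have d₁ := D (by omega) (hF.upper (k := k) (by omega))
    have d₂ := D (by omega) (hF.lower (k := k) (by omega))
    have em : m * n = 4 * k * n + 4 * n := by rw [e]; ring
    clear hF D prev
    generalize 4 * k * n = T at *
    refine ⟨fun hj => ?_, fun hj => ?_, fun hj => ?_, fun hj => ?_, fun hj => ?_, fun hj => ?_⟩ <;>
      omega
  · have d₁ := D (by omega) (hF.upper (k := k) (by omega))
    have d₂ := D (by omega) (hF.lower (k := k) (by omega))
    have d₃ := D (by omega) (hF.last (k := k + 1) (by omega))
    rw [show 4 * (k + 1) * n = 4 * k * n + 4 * n by ring] at d₃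
    clear hF D prev hmax b
    generalize 4 * k * n = T at *
    refine ⟨fun hj => ?_, fun hj => ?_, fun hj => ?_, fun hj => ?_, fun hj => ?_, fun hj => ?_⟩ <;>
      omega
  · have d₁ := D (by omega) (hF.upper (k := k) (by omega))
    have d₂ := D (by omega) (hF.lower (k := k) (by omega))
    have d₃ := D (by omega) (hF.upper (k := k + 1) (by omega))
    rw [show 4 * (k + 1) * n = 4 * k * n + 4 * n by ring] at d₃
    clear hF D prev hmax b
    generalize 4 * k * n = T at *
    refine ⟨fun hj => ?_, fun hj => ?_, fun hj => ?_, fun hj => ?_, fun hj => ?_, fun hj => ?_⟩ <;>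
      omega

/-- The clues force the last column. -/
theorem last_column (h : IsLabelling m n F) (hF : MatchesClues m n F)
    (hm : 3 ≤ m) (hn : 2 ≤ n) {r : ℕ} (hr : r < m) :
    F r (n - 1) = zigzag n r (n - 1) := by
  have hc : n - 1 < n := by omega
  have first : F 0 (n - 1) = 1 := by
    rcases h.last_column_candidates hF hm hn (r := 0) (by omega) with ⟨k, T, hT, H⟩ | H | H
    · obtain rfl : k = 0 := by omega
      omega
    · exact H.1
    · omega
  have final : m % 2 = 0 → F (m - 1) (n - 1) = m * n := by
    intro hm2
    rcases h.last_column_candidates hF hm hn (r := m - 1) (by omega) with ⟨k, T, hT, H⟩ | H | H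
    · rcases (show m = 4 * k + 2 ∨ m = 4 * k + 4 by omega) with e | e
      · have em : m * n = T + 2 * n := by rw [hT, e]; ring
        omega
      · have em : m * n = T + 4 * n := by rw [hT, e]; ring
        omega
    · omega
    · exact H.1
  have val : ∀ k j, r = 4 * k + j → zigzag n r (n - 1) =
      4 * k * n + j * n + if j % 2 = 1 then n else 1 := by
    intro k j e
    rw [zigzag, e, add_mul, show (4 * k + j) % 2 = j % 2 by omega]
    split_ifs <;> omega
  rcases h.last_column_candidates hF hm hn hr with ⟨k, T, rfl, H⟩ | H | H
  · rcases H with ⟨e, H | ⟨hk, H⟩⟩ | ⟨e, H | ⟨hk, H⟩⟩ | ⟨e, H | H⟩ | ⟨e, H⟩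
    · rw [H, val k 0 e]; simp
    · subst e
      obtain ⟨k, rfl⟩ : ∃ k', k = k' + 1 := ⟨k - 1, by omega⟩
      have e₁ := hF.last (k := k + 1) (by omega)
      have e₂ := hF.lower (k := k) (by omega)
      have e₃ : 4 * (k + 1) * n = 4 * k * n + 4 * n := by ring
      have := h.mul_add_le_of_filled_below hr (s := 4 * (k + 1) * n + n) (x := 4 * k + 2) (y := 0)
        e₁ (by omega) (by omega) (by omega) (by omega) (by omega)
      rw [hk, show 4 * (k + 1) + 2 - (4 * (k + 1) + 1) = 1 by omega, add_mul] at this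
      omega
    · rw [H, val k 1 e, if_pos (by omega)]; omega
    · subst e
      have e₁ := hF.upper hk
      have e₂ := hF.lower hk
      have := h.mul_lt_of_filled_above hr (s := 4 * k * n + 2) (x := 4 * k + 2) (y := 0)
        (by omega) H (by omega) (by omega) (by omega) (by omega)
      rw [add_mul] at this
      omega
    · rw [H, val k 2 e, if_neg (by omega)]
    · subst e
      have e₁ := hF.upper (k := k) (by omega)
      have e₂ := hF.lower (k := k) (by omega)
      have := h.mul_add_le_of_filled_below hr (s := 4 * k * n + 3 * n) (x := 4 * k + 1) (y := 0)
        (by omega) (by omega) (by omega) (by omega) (by omega) (by omega)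
      have b := (h.bound hr hc).2
      obtain ⟨d, rfl⟩ : ∃ d, m = 4 * k + 2 + 1 + d := ⟨m - (4 * k + 3), by omega⟩
      rw [Nat.add_sub_cancel_left,
        show (4 * k + 2 + 1 + d) * n = 4 * k * n + 3 * n + d * n by ring] at this
      rw [show (4 * k + 2 + 1 + d) * n = 4 * k * n + 3 * n + d * n by ring] at b
      omega
    · rw [H, val k 3 e, if_pos (by omega)]; omega
  · obtain ⟨rfl, -⟩ := h.inj hr hc (by omega) hc (H.1.trans first.symm)
    rw [first, val 0 0 rfl]; simp
  · obtain ⟨e, -⟩ := h.inj hr hc (by omega) hc (H.1.trans (final H.2.1).symm)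
    obtain ⟨d, rfl⟩ : ∃ d, m = d + 1 := ⟨m - 1, by omega⟩
    obtain rfl : r = d := by omega
    rw [H.1, zigzag, if_pos (by omega), add_mul]
    omega

/-- The last column forces all the others. -/
theorem eq_zigzag (h : IsLabelling m n F)
    (hlast : ∀ r < m, F r (n - 1) = zigzag n r (n - 1)) {r c : ℕ} (hr : r < m) (hc : c < n) :
    F r c = zigzag n r c := by
  suffices H : ∀ d c, c + d + 1 = n → ∀ c', c ≤ c' → c' < n → ∀ r < m,
      F r c' = zigzag n r c' from
    H (n - 1 - c) c (by omega) c le_rfl hc r hr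
  intro d
  induction d with
  | zero =>
    intro c hcn c' hcc' hc' r hr
    obtain rfl : c' = n - 1 := by omega
    exact hlast r hr
  | succ d ih =>
    intro c hcn c' hcc' hc' r hr
    have known := ih (c + 1) (by omega)
    rcases (show c + 1 ≤ c' ∨ c' = c by omega) with hlt | rfl
    · exact known c' hlt hc' r hr
    have hself := known (c' + 1) le_rfl (by omega) r hr
    have htop := Nat.mul_le_mul_right n (show r + 1 ≤ m from hr)
    have hrn : (r + 1) * n = r * n + n := by ring
    have hup : ∀ x, x = r + 1 → x * n = r * n + n := by rintro x rfl; ring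
    have hdown : ∀ x, x + 1 = r → r * n = x * n + n := by rintro x rfl; ring
    unfold zigzag at *
    by_cases hpar : r % 2 = 1
    · rw [if_pos hpar] at hself ⊢
      obtain ⟨x, y, hx, hy, exy⟩ := h.surj (t := r * n + (c' + 1)) (by omega) (by omega)
      have hs := h.step hx hy hr (show c' + 1 < n by omega) (by omega)
      by_cases hyc : y = c'
      · obtain rfl : x = r := by omega
        rw [← exy, hyc]
      · exfalso
        have hk := known y (by omega) hy x hx
        rcases hs with ⟨rfl, -⟩ | ⟨rfl, e | e⟩
        · rw [if_pos hpar] at hk; omega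
        · have := hdown x e
          rw [if_neg (by omega)] at hk; omega
        · have := hup x e.symm
          rw [if_neg (by omega)] at hk; omega
    · rw [if_neg hpar] at hself ⊢
      obtain ⟨x, y, hx, hy, exy⟩ := h.surj (t := r * n + (n - c')) (by omega) (by omega)
      have hs := h.step hr (show c' + 1 < n by omega) hx hy (by omega)
      by_cases hyc : y = c'
      · obtain rfl : x = r := by omega
        rw [← exy, hyc]
      · exfalso
        have hk := known y (by omega) hy x hx
        rcases hs with ⟨rfl, -⟩ | ⟨rfl, e | e⟩
        · rw [if_neg hpar] at hk; omega
        · have := hup x e.symm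
          rw [if_pos (by omega)] at hk; omega
        · have := hdown x e
          rw [if_pos (by omega)] at hk; omega

end IsLabelling

theorem zigzag_mem_Ioc {n r c : ℕ} (hc : c < n) :
    r * n < zigzag n r c ∧ zigzag n r c ≤ r * n + n := by
  unfold zigzag
  split_ifs <;> omega

theorem isNumbrix_zigzag (m n : ℕ) :
    IsNumbrix fun p : Fin m × Fin n => zigzag n p.1 p.2 := by
  refine ⟨fun ⟨r, c⟩ => ?_, fun ⟨r, c⟩ ⟨r', c'⟩ e => ?_, fun ⟨r, c⟩ ⟨r', c'⟩ e => ?_⟩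
  · have := zigzag_mem_Ioc (r := r) c.2
    have := Nat.mul_le_mul_right n (show r.1 + 1 ≤ m from r.2)
    rw [add_mul] at this
    dsimp only
    omega
  · dsimp only at e
    have b := zigzag_mem_Ioc (r := r) c.2
    have b' := zigzag_mem_Ioc (r := r') c'.2
    obtain hlt | heq | hlt := lt_trichotomy r.1 r'.1
    · have := Nat.mul_le_mul_right n (show r.1 + 1 ≤ r' from hlt)
      rw [add_mul] at this
      omega
    · unfold zigzag at e
      rw [heq] at e
      have := c.2
      have := c'.2
      have : c.1 = c'.1 := by split_ifs at e <;> omega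
      simp [Fin.ext_iff, heq, this]
    · have := Nat.mul_le_mul_right n (show r'.1 + 1 ≤ r from hlt)
      rw [add_mul] at this
      omega
  · dsimp only at e
    have b := zigzag_mem_Ioc (r := r) c.2
    have b' := zigzag_mem_Ioc (r := r') c'.2
    have hc := c.2
    have hc' := c'.2
    simp only [Adj, Fin.ext_iff]
    rcases (show r'.1 < r ∨ r'.1 = r ∨ r'.1 = r + 1 ∨ r.1 + 2 ≤ r' by omega) with
      hlt | heq | heq | hlt
    · have := Nat.mul_le_mul_right n (show r'.1 + 1 ≤ r from hlt)
      rw [add_mul] at this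
      omega
    · unfold zigzag at e
      rw [heq] at e
      split_ifs at e <;> omega
    · unfold zigzag at e
      rw [heq, add_mul] at e
      split_ifs at e <;> omega
    · have := Nat.mul_le_mul_right n hlt
      rw [add_mul] at this
      omega

/-- Numbrix solutions hit every value, so they are labellings. -/
theorem IsNumbrix.isLabelling {m n : ℕ} {f : Fin m × Fin n → ℕ} (hf : IsNumbrix f)
    {F : ℕ → ℕ → ℕ} (hF : ∀ (r : Fin m) (c : Fin n), F r c = f (r, c)) : IsLabelling m n F := by
  obtain ⟨hb, hi, hs⟩ := hf
  refine ⟨fun {r c} hr hc => ?_, fun {r c r' c'} hr hc hr' hc' e => ?_, fun {t} h₁ h₂ => ?_,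
    fun {r c r' c'} hr hc hr' hc' e => ?_⟩
  · simpa [hF ⟨r, hr⟩ ⟨c, hc⟩] using hb (⟨r, hr⟩, ⟨c, hc⟩)
  · have := hi ((hF ⟨r, hr⟩ ⟨c, hc⟩).symm.trans (e.trans (hF ⟨r', hr'⟩ ⟨c', hc'⟩)))
    simpa using this
  · have himg : Finset.univ.image f = Finset.Icc 1 (m * n) := by
      apply Finset.eq_of_subset_of_card_le
      · intro t ht
        obtain ⟨p, -, rfl⟩ := Finset.mem_image.1 ht
        exact Finset.mem_Icc.2 (hb p)
      · rw [Finset.card_image_of_injective _ hi]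
        simp
    obtain ⟨⟨r, c⟩, -, e⟩ := Finset.mem_image.1 (himg ▸ Finset.mem_Icc.2 ⟨h₁, h₂⟩)
    exact ⟨r, c, r.2, c.2, (hF r c).trans e⟩
  · have := hs (⟨r, hr⟩, ⟨c, hc⟩) (⟨r', hr'⟩, ⟨c', hc'⟩)
      ((hF ⟨r', hr'⟩ ⟨c', hc'⟩).symm.trans (e.trans (by rw [← hF ⟨r, hr⟩ ⟨c, hc⟩])))
    simpa [Adj, Fin.ext_iff] using this

theorem min_clues_upper_bound (m n : ℕ) (hm : 3 ≤ m) (hmn : m ≤ n) :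
    ∃ S : Finset ((Fin m × Fin n) × ℕ),
      S.card ≤ (m + 1) / 2 ∧
      ∃! f : Fin m × Fin n → ℕ, IsNumbrix f ∧ ∀ p ∈ S, f p.1 = p.2 := by
  have hn : 0 < n := by omega
  let clue : Fin ((m + 1) / 2) → (Fin m × Fin n) × ℕ := fun i =>
    ((⟨clueRow m i, clueRow_lt i.2⟩, ⟨0, hn⟩), zigzag n (clueRow m i) 0)
  refine ⟨Finset.univ.image clue, by simpa using Finset.card_image_le (s := Finset.univ) (f := clue),
    fun p => zigzag n p.1 p.2, ⟨isNumbrix_zigzag m n, ?_⟩, ?_⟩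
  · intro p hp
    obtain ⟨i, -, rfl⟩ := Finset.mem_image.1 hp
    rfl
  · rintro f ⟨hf, hclue⟩
    let F : ℕ → ℕ → ℕ := fun r c => if h : r < m ∧ c < n then f (⟨r, h.1⟩, ⟨c, h.2⟩) else 0
    have hFf : ∀ (r : Fin m) (c : Fin n), F r c = f (r, c) := fun r c => by
      simp [F]
    have hlab := hf.isLabelling hFf
    have hmatch : MatchesClues m n F := fun i hi => by
      have := hclue (clue ⟨i, hi⟩) (Finset.mem_image_of_mem _ (Finset.mem_univ _))
      exact (hFf ⟨clueRow m i, clueRow_lt hi⟩ ⟨0, hn⟩).trans this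
    funext ⟨r, c⟩
    rw [← hFf]
    exact hlab.eq_zigzag (fun r hr => hlab.last_column hmatch hm (by omega) hr) r.2 c.2
end

section
/- For every odd n ≥ 3, no single clue defines a 3 × n Numbrix puzzle: for every cell c and value v such that some solution f has f(c) = v, there exist at least two distinct solutions g with g(c) = v. Combined with the 2-clue construction, the minimum number of clues defining a 3 × n puzzle is exactly 2 for all n ≥ 3. -/
namespace IsNumbrix

section General

variable {m n : ℕ} {f : Fin m × Fin n → ℕ}

theorem exists_eq (hf : IsNumbrix f) {k : ℕ} (hk : 1 ≤ k) (hk' : k ≤ m * n) : ∃ c, f c = k := by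
  have hsub : Finset.univ.image f ⊆ Finset.Icc 1 (m * n) := by
    intro x hx
    obtain ⟨c, -, rfl⟩ := Finset.mem_image.1 hx
    exact Finset.mem_Icc.2 (hf.1 c)
  have himage : Finset.univ.image f = Finset.Icc 1 (m * n) := by
    refine Finset.eq_of_subset_of_card_le hsub ?_
    rw [Finset.card_image_of_injective _ hf.2.1]
    simp
  have hmem : k ∈ Finset.univ.image f := by
    rw [himage]
    exact Finset.mem_Icc.2 ⟨hk, hk'⟩
  obtain ⟨c, -, hc⟩ := Finset.mem_image.1 hmem
  exact ⟨c, hc⟩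

/-- The grid distance of two cells is at most the difference of their values, and congruent to it
modulo 2. -/
theorem dist_le_and_parity (hf : IsNumbrix f) {d : ℕ} {a b : Fin m × Fin n} (hab : f b = f a + d) :
    (a.1 : ℕ) + a.2 ≤ b.1 + b.2 + d ∧ (b.1 : ℕ) + b.2 ≤ a.1 + a.2 + d ∧
      (a.1 : ℕ) + b.2 ≤ b.1 + a.2 + d ∧ (b.1 : ℕ) + a.2 ≤ a.1 + b.2 + d ∧
      ((a.1 : ℕ) + a.2 + f a) % 2 = ((b.1 : ℕ) + b.2 + f b) % 2 := by
  induction d generalizing b with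
  | zero =>
    obtain rfl := hf.2.1 (by simpa using hab)
    simp
  | succ d ih =>
    have hb := hf.1 b
    have ha := hf.1 a
    obtain ⟨e, he⟩ := hf.exists_eq (k := f a + d) (by omega) (by omega)
    have h := ih he
    have hadj := hf.2.2 e b (by omega)
    simp only [Adj, Fin.ext_iff] at hadj
    omega

theorem of_step {F : ℕ → ℕ → ℕ} (hrange : ∀ r s, r < m → s < n → 1 ≤ F r s ∧ F r s ≤ m * n)
    (hone : ∃ r s, r < m ∧ s < n ∧ F r s = 1)
    (hstep : ∀ r s, r < m → s < n → F r s < m * n → ∃ r' s', r' < m ∧ s' < n ∧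
      (r = r' ∧ (s + 1 = s' ∨ s' + 1 = s) ∨ s = s' ∧ (r + 1 = r' ∨ r' + 1 = r)) ∧
      F r' s' = F r s + 1) :
    IsNumbrix (fun c : Fin m × Fin n => F c.1 c.2) := by
  have hsurj : ∀ k, 1 ≤ k → k ≤ m * n → ∃ c : Fin m × Fin n, F c.1 c.2 = k := by
    intro k hk
    induction k, hk using Nat.le_induction with
    | base =>
      obtain ⟨r, s, hr, hs, h⟩ := hone
      exact fun _ => ⟨(⟨r, hr⟩, ⟨s, hs⟩), h⟩
    | succ k hk ih =>
      intro hk'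
      obtain ⟨c, hc⟩ := ih (by omega)
      obtain ⟨r, s, hr, hs, -, h⟩ := hstep c.1 c.2 c.1.2 c.2.2 (by omega)
      exact ⟨(⟨r, hr⟩, ⟨s, hs⟩), by rw [h, hc]⟩
  have hinj : Function.Injective (fun c : Fin m × Fin n => F c.1 c.2) := by
    have himage : Finset.Icc 1 (m * n) ⊆
        Finset.univ.image (fun c : Fin m × Fin n => F c.1 c.2) := by
      intro k hk
      obtain ⟨hk, hk'⟩ := Finset.mem_Icc.1 hk
      obtain ⟨c, hc⟩ := hsurj k hk hk'
      exact Finset.mem_image.2 ⟨c, Finset.mem_univ _, hc⟩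
    rw [← Set.injOn_univ, ← Finset.coe_univ, ← Finset.card_image_iff]
    refine le_antisymm Finset.card_image_le ?_
    simpa using Finset.card_le_card himage
  refine ⟨fun c => hrange _ _ c.1.2 c.2.2, hinj, fun c c' hcc => ?_⟩
  dsimp only at hcc
  obtain ⟨r, s, hr, hs, hadj, h⟩ := hstep c.1 c.2 c.1.2 c.2.2 (by
    have := hrange _ _ c'.1.2 c'.2.2
    omega)
  have : c' = (⟨r, hr⟩, ⟨s, hs⟩) := hinj (by simp only; omega)
  subst this
  simpa [Adj, Fin.ext_iff] using hadj

theorem reverse (hf : IsNumbrix f) : IsNumbrix (fun c => m * n + 1 - f c) := by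
  refine ⟨fun c => ?_, fun a b hab => ?_, fun a b hab => ?_⟩
  · have := hf.1 c
    dsimp only
    omega
  · have ha := hf.1 a
    have hb := hf.1 b
    exact hf.2.1 (by dsimp only at hab; omega)
  · have ha := hf.1 a
    have hb := hf.1 b
    have := hf.2.2 b a (by dsimp only at hab; omega)
    unfold Adj at *
    grind

theorem flipRows (hf : IsNumbrix f) : IsNumbrix (fun c => f (c.1.rev, c.2)) := by
  refine ⟨fun c => hf.1 _, fun a b hab => ?_, fun a b hab => ?_⟩
  · have := hf.2.1 hab
    simpa [Prod.ext_iff] using this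
  · have h := hf.2.2 _ _ hab
    simp only [Adj, Fin.ext_iff, Fin.val_rev] at *
    omega

theorem flipCols (hf : IsNumbrix f) : IsNumbrix (fun c => f (c.1, c.2.rev)) := by
  refine ⟨fun c => hf.1 _, fun a b hab => ?_, fun a b hab => ?_⟩
  · have := hf.2.1 hab
    simpa [Prod.ext_iff] using this
  · have h := hf.2.2 _ _ hab
    simp only [Adj, Fin.ext_iff, Fin.val_rev] at *
    omega

/-- A closed solution may be rotated. -/
theorem rotate (hf : IsNumbrix f) (hclosed : ∀ c c', f c = m * n → f c' = 1 → Adj c c') {k : ℕ}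
    (hk : k < m * n) :
    IsNumbrix (fun c => if f c + k ≤ m * n then f c + k else f c + k - m * n) := by
  refine ⟨fun c => ?_, fun a b hab => ?_, fun a b hab => ?_⟩
  · have := hf.1 c
    dsimp only
    split_ifs <;> omega
  · have ha := hf.1 a
    have hb := hf.1 b
    refine hf.2.1 ?_
    dsimp only at hab
    split_ifs at hab <;> omega
  · have ha := hf.1 a
    have hb := hf.1 b
    have : f b = f a + 1 ∨ (f a = m * n ∧ f b = 1) := by
      dsimp only at hab
      split_ifs at hab <;> omega
    rcases this with h | ⟨h, h'⟩
    · exact hf.2.2 a b h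
    · exact hclosed a b h h'

end General

end IsNumbrix

/-- At least two solutions carry the value `v` at the cell `c`. -/
def Ambiguous {m n : ℕ} (c : Fin m × Fin n) (v : ℕ) : Prop :=
  ∃ g h : Fin m × Fin n → ℕ, IsNumbrix g ∧ IsNumbrix h ∧ g c = v ∧ h c = v ∧ g ≠ h

namespace Ambiguous

variable {m n : ℕ} {c : Fin m × Fin n} {v : ℕ}

theorem of_flipRows (h : Ambiguous (c.1.rev, c.2) v) : Ambiguous c v := by
  obtain ⟨g, h, hg, hh, hgc, hhc, hne⟩ := h
  refine ⟨_, _, hg.flipRows, hh.flipRows, hgc, hhc, fun heq => hne (funext fun x => ?_)⟩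
  simpa using congrFun heq (x.1.rev, x.2)

theorem of_flipCols (h : Ambiguous (c.1, c.2.rev) v) : Ambiguous c v := by
  obtain ⟨g, h, hg, hh, hgc, hhc, hne⟩ := h
  refine ⟨_, _, hg.flipCols, hh.flipCols, hgc, hhc, fun heq => hne (funext fun x => ?_)⟩
  simpa using congrFun heq (x.1, x.2.rev)

theorem of_reverse (hv : v ≤ m * n) (h : Ambiguous c (m * n + 1 - v)) : Ambiguous c v := by
  obtain ⟨g, h, hg, hh, hgc, hhc, hne⟩ := h
  refine ⟨_, _, hg.reverse, hh.reverse, by omega, by omega,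
    fun heq => hne (funext fun x => ?_)⟩
  have := congrFun heq x
  have hgx := hg.1 x
  have hhx := hh.1 x
  omega

end Ambiguous

/-- Bottom left `2 × w` block traversed as a U, then the top row from left to right, then the rest
of the lower two rows as a U. -/
def uPath (n w r s : ℕ) : ℕ :=
  if r = 0 then 2 * w + 1 + s
  else if s < w then (if r = 1 then 2 * w - s else s + 1)
  else if r = 1 then 2 * w + 2 * n - s else 2 * n + 1 + s

/-- The variant of `uPath` that zigzags through the bottom left `2 × w` block. -/
def zigzagPath (n w r s : ℕ) : ℕ :=
  if r = 0 then 2 * w + 1 + s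
  else if s < w then (if (r + s) % 2 = 1 then 2 * w - 2 * s else 2 * w - 2 * s - 1)
  else if r = 1 then 2 * w + 2 * n - s else 2 * n + 1 + s

/-- The top row from column `m` to the right, then a zigzag back through the lower two rows. -/
def hookPath (n m r s : ℕ) : ℕ :=
  if r = 0 then s + 1 - m
  else if (r + s) % 2 = 1 then n + 1 - m + 2 * (n - 1 - s) else n + 2 - m + 2 * (n - 1 - s)

/-- `hookPath` followed by a snake along the columns left of column `m`. -/
def hookColumns (n m r s : ℕ) : ℕ :=
  if m ≤ s then hookPath n m r s
  else 3 * (n - m) + 1 + 3 * (m - 1 - s) + (if s % 2 = 1 then 2 - r else r)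

/-- `hookPath` followed by a snake along the rows left of column `m`. -/
def hookRows (n m r s : ℕ) : ℕ :=
  if m ≤ s then hookPath n m r s
  else 3 * (n - m) + 1 + (if r = 2 then m - 1 - s else if r = 1 then m + s else 3 * m - 1 - s)

/-- The top row from left to right, then a zigzag back through the lower two rows; for even `n`
this path is closed. -/
def combPath (n r s : ℕ) : ℕ :=
  if r = 0 then s + 1
  else if (r + s) % 2 = 0 then n + 1 + 2 * (n - 1 - s) else n + 2 + 2 * (n - 1 - s)

theorem uPath_isNumbrix {n w : ℕ} (hw : 1 ≤ w) (hwn : w ≤ n) :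
    IsNumbrix (fun c : Fin 3 × Fin n => uPath n w c.1 c.2) := by
  refine IsNumbrix.of_step (F := uPath n w) (fun r s hr hs => ?_) ⟨2, 0, ?_⟩
    fun r s hr hs hlt => ?_
  · grind [uPath]
  · grind [uPath]
  · have hcases : (r = 0 ∧ s + 1 < n) ∨ (r = 0 ∧ s + 1 = n) ∨ (r = 1 ∧ s = 0 ∧ s < w) ∨
        (r = 1 ∧ s = w) ∨ (r = 1 ∧ 0 < s ∧ s ≠ w) ∨ (r = 2 ∧ s + 1 = w) ∨
        (r = 2 ∧ s + 1 ≠ w) := by omega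
    rcases hcases with h | h | h | h | h | h | h
    · exact ⟨0, s + 1, by grind [uPath]⟩
    · exact ⟨1, s, by grind [uPath]⟩
    · exact ⟨0, s, by grind [uPath]⟩
    · exact ⟨2, s, by grind [uPath]⟩
    · exact ⟨1, s - 1, by grind [uPath]⟩
    · exact ⟨1, s, by grind [uPath]⟩
    · exact ⟨2, s + 1, by grind [uPath]⟩

theorem zigzagPath_isNumbrix {n w : ℕ} (hw : 1 ≤ w) (hwn : w ≤ n) :
    IsNumbrix (fun c : Fin 3 × Fin n => zigzagPath n w c.1 c.2) := by
  refine IsNumbrix.of_step (F := zigzagPath n w) (fun r s hr hs => ?_) ⟨1 + w % 2, w - 1, ?_⟩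
    fun r s hr hs hlt => ?_
  · grind [zigzagPath]
  · grind [zigzagPath]
  · have hcases : (r = 0 ∧ s + 1 < n) ∨ (r = 0 ∧ s + 1 = n) ∨
        (r = 1 ∧ s = 0 ∧ s < w) ∨ (r ≠ 0 ∧ s < w ∧ 0 < s ∧ (r + s) % 2 = 1) ∨
        (r ≠ 0 ∧ s < w ∧ (r + s) % 2 = 0) ∨
        (r = 1 ∧ s = w) ∨ (r = 1 ∧ w < s) ∨ (r = 2 ∧ w ≤ s) := by omega
    rcases hcases with h | h | h | h | h | h | h | h
    · exact ⟨0, s + 1, by grind [zigzagPath]⟩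
    · exact ⟨1, s, by grind [zigzagPath]⟩
    · exact ⟨0, s, by grind [zigzagPath]⟩
    · exact ⟨r, s - 1, by grind [zigzagPath]⟩
    · exact ⟨3 - r, s, by grind [zigzagPath]⟩
    · exact ⟨2, s, by grind [zigzagPath]⟩
    · exact ⟨1, s - 1, by grind [zigzagPath]⟩
    · exact ⟨2, s + 1, by grind [zigzagPath]⟩

theorem hookPath_step {n m r s : ℕ} (hn : n % 2 = 1) (hm : m % 2 = 0) (hr : r < 3) (hs : s < n)
    (hms : m ≤ s) (hend : ¬(r = 2 ∧ s = m)) :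
    ∃ r' s', r' < 3 ∧ s' < n ∧ m ≤ s' ∧
      (r = r' ∧ (s + 1 = s' ∨ s' + 1 = s) ∨ s = s' ∧ (r + 1 = r' ∨ r' + 1 = r)) ∧
      hookPath n m r' s' = hookPath n m r s + 1 := by
  have hcases : (r = 0 ∧ s + 1 < n) ∨ (r = 0 ∧ s + 1 = n) ∨ (r ≠ 0 ∧ (r + s) % 2 = 1) ∨
      (r ≠ 0 ∧ m < s ∧ (r + s) % 2 = 0) := by omega
  rcases hcases with h | h | h | h
  · exact ⟨0, s + 1, by grind [hookPath]⟩
  · exact ⟨1, s, by grind [hookPath]⟩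
  · exact ⟨3 - r, s, by grind [hookPath]⟩
  · exact ⟨r, s - 1, by grind [hookPath]⟩

theorem hookColumns_isNumbrix {n m : ℕ} (hn : n % 2 = 1) (hm : m % 2 = 0) (hmn : m < n) :
    IsNumbrix (fun c : Fin 3 × Fin n => hookColumns n m c.1 c.2) := by
  refine IsNumbrix.of_step (F := hookColumns n m) (fun r s hr hs => ?_) ⟨0, m, ?_⟩
    fun r s hr hs hlt => ?_
  · grind [hookColumns, hookPath]
  · grind [hookColumns, hookPath]
  · by_cases hpath : m ≤ s ∧ ¬(r = 2 ∧ s = m)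
    · obtain ⟨r', s', hr', hs', hms, hadj, hnext⟩ := hookPath_step hn hm hr hs hpath.1 hpath.2
      refine ⟨r', s', hr', hs', hadj, ?_⟩
      rw [hookColumns, hookColumns, if_pos hms, if_pos hpath.1, hnext]
    have hcases : (r = 2 ∧ s = m ∧ 0 < m) ∨ (s < m ∧ s % 2 = 1 ∧ 0 < r) ∨
        (s < m ∧ s % 2 = 1 ∧ r = 0) ∨ (s < m ∧ s % 2 = 0 ∧ r < 2) ∨
        (s < m ∧ s % 2 = 0 ∧ r = 2 ∧ 0 < s) := by
      have hlast : ¬(r = 2 ∧ s = 0 ∧ s < m) := by grind [hookColumns]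
      have hlast' : ¬(r = 2 ∧ s = m ∧ m = 0) := by grind [hookColumns, hookPath]
      omega
    rcases hcases with h | h | h | h | h
    · exact ⟨2, s - 1, by grind [hookColumns, hookPath]⟩
    · exact ⟨r - 1, s, by grind [hookColumns, hookPath]⟩
    · exact ⟨0, s - 1, by grind [hookColumns, hookPath]⟩
    · exact ⟨r + 1, s, by grind [hookColumns, hookPath]⟩
    · exact ⟨2, s - 1, by grind [hookColumns, hookPath]⟩

theorem hookRows_isNumbrix {n m : ℕ} (hn : n % 2 = 1) (hm : m % 2 = 0) (hmn : m < n) :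
    IsNumbrix (fun c : Fin 3 × Fin n => hookRows n m c.1 c.2) := by
  refine IsNumbrix.of_step (F := hookRows n m) (fun r s hr hs => ?_) ⟨0, m, ?_⟩
    fun r s hr hs hlt => ?_
  · grind [hookRows, hookPath]
  · grind [hookRows, hookPath]
  · by_cases hpath : m ≤ s ∧ ¬(r = 2 ∧ s = m)
    · obtain ⟨r', s', hr', hs', hms, hadj, hnext⟩ := hookPath_step hn hm hr hs hpath.1 hpath.2
      refine ⟨r', s', hr', hs', hadj, ?_⟩
      rw [hookRows, hookRows, if_pos hms, if_pos hpath.1, hnext]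
    have hcases : (r = 2 ∧ s = m ∧ 0 < m) ∨ (s < m ∧ r ≠ 1 ∧ 0 < s) ∨ (r = 2 ∧ s = 0 ∧ s < m) ∨
        (r = 1 ∧ s + 1 < m) ∨ (r = 1 ∧ s + 1 = m) := by
      grind [hookRows, hookPath]
    rcases hcases with h | h | h | h | h
    · exact ⟨2, s - 1, by grind [hookRows, hookPath]⟩
    · exact ⟨r, s - 1, by grind [hookRows, hookPath]⟩
    · exact ⟨1, 0, by grind [hookRows, hookPath]⟩
    · exact ⟨1, s + 1, by grind [hookRows, hookPath]⟩
    · exact ⟨0, s, by grind [hookRows, hookPath]⟩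

theorem combPath_isNumbrix {n : ℕ} (hn : n % 2 = 0) (hpos : 0 < n) :
    IsNumbrix (fun c : Fin 3 × Fin n => combPath n c.1 c.2) := by
  refine IsNumbrix.of_step (F := combPath n) (fun r s hr hs => ?_) ⟨0, 0, ?_⟩
    fun r s hr hs hlt => ?_
  · grind [combPath]
  · grind [combPath]
  · have hcases : (r = 0 ∧ s + 1 < n) ∨ (r = 0 ∧ s + 1 = n) ∨ (r ≠ 0 ∧ (r + s) % 2 = 0) ∨
        (r ≠ 0 ∧ 0 < s ∧ (r + s) % 2 = 1) := by
      grind [combPath]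
    rcases hcases with h | h | h | h
    · exact ⟨0, s + 1, by grind [combPath]⟩
    · exact ⟨1, s, by grind [combPath]⟩
    · exact ⟨3 - r, s, by grind [combPath]⟩
    · exact ⟨r, s - 1, by grind [combPath]⟩

theorem combPath_closed {n : ℕ} (hn : n % 2 = 0) (c c' : Fin 3 × Fin n)
    (hc : combPath n c.1 c.2 = 3 * n) (hc' : combPath n c'.1 c'.2 = 1) : Adj c c' := by
  obtain ⟨⟨r, hr⟩, s, hs⟩ := c
  obtain ⟨⟨r', hr'⟩, s', hs'⟩ := c'
  simp only [Adj, Fin.ext_iff]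
  unfold combPath at hc hc'
  split_ifs at hc hc' <;> dsimp only at * <;> omega

theorem Ambiguous.of_closed {m n : ℕ} {f : Fin m × Fin n → ℕ} (hf : IsNumbrix f)
    (hclosed : ∀ c c', f c = m * n → f c' = 1 → Adj c c') (hmn : 3 ≤ m * n) (c : Fin m × Fin n)
    {v : ℕ} (hv : 1 ≤ v) (hv' : v ≤ m * n) : Ambiguous c v := by
  have hc := hf.1 c
  obtain ⟨k, hk, hkv⟩ : ∃ k < m * n, f c + k = v ∨ f c + k = v + m * n := by
    rcases le_or_gt (f c) v with h | h
    · exact ⟨v - f c, by omega, by omega⟩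
    · exact ⟨v + m * n - f c, by omega, by omega⟩
  obtain ⟨l, hl, hlv⟩ : ∃ l < m * n, f c + v = l + 1 ∨ f c + v = l + 1 + m * n := by
    rcases le_or_gt (f c + v) (m * n) with h | h
    · exact ⟨f c + v - 1, by omega, by omega⟩
    · exact ⟨f c + v - 1 - m * n, by omega, by omega⟩
  have hclosed' : ∀ a b, m * n + 1 - f a = m * n → m * n + 1 - f b = 1 → Adj a b := by
    intro a b ha hb
    have ha' := hf.1 a
    have hb' := hf.1 b
    have := hclosed b a (by omega) (by omega)
    unfold Adj at *
    grind
  refine ⟨_, _, hf.rotate hclosed hk, hf.reverse.rotate hclosed' hl, ?_, ?_, fun heq => ?_⟩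
  · split_ifs <;> omega
  · split_ifs <;> omega
  · obtain ⟨d, hd⟩ : ∃ d, f d = if f c = m * n then 1 else f c + 1 := by
      apply hf.exists_eq <;> split_ifs <;> omega
    have := congrFun heq d
    split_ifs at this hd <;> omega

theorem ambiguous_of_even {n : ℕ} (hn : n % 2 = 0) (hpos : 0 < n) (c : Fin 3 × Fin n) {v : ℕ}
    (hv : 1 ≤ v) (hv' : v ≤ 3 * n) : Ambiguous c v :=
  Ambiguous.of_closed (combPath_isNumbrix hn hpos) (combPath_closed hn) (by omega) c hv hv'

/-- A solution may be reflected in the middle row. -/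
theorem ambiguous_of_middle_row {n : ℕ} (hn : 0 < n) {f : Fin 3 × Fin n → ℕ} (hf : IsNumbrix f)
    (j : Fin n) : Ambiguous ((1 : Fin 3), j) (f (1, j)) := by
  refine ⟨f, _, hf, hf.flipRows, rfl, rfl, fun heq => ?_⟩
  have h : f (0, ⟨0, hn⟩) = f (2, ⟨0, hn⟩) := congrFun heq (0, ⟨0, hn⟩)
  simpa using hf.2.1 h

theorem ambiguous_top_row_of_two_le {n w : ℕ} (hw : 2 ≤ w) (hwn : w ≤ n) (j : Fin n) :
    Ambiguous ((0 : Fin 3), j) (j + 1 + 2 * w) := by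
  refine ⟨_, _, uPath_isNumbrix (by omega) hwn, zigzagPath_isNumbrix (by omega) hwn, ?_, ?_,
    fun heq => ?_⟩
  · simp [uPath]
    omega
  · simp [zigzagPath]
    omega
  · have h := congrFun heq (2, ⟨0, by omega⟩)
    simp only [uPath, zigzagPath, Fin.val_two] at h
    split_ifs at h <;> omega

theorem ambiguous_top_row_of_le {n w : ℕ} (hn : 3 ≤ n) (hwn : w ≤ n) (j : Fin n) :
    Ambiguous ((0 : Fin 3), j) (j + 1 + 2 * w) := by
  rcases le_or_gt 2 w with hw | hw
  · exact ambiguous_top_row_of_two_le hw hwn j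
  · have hj := j.2
    have h := ambiguous_top_row_of_two_le (w := n - w) (by omega) (by omega) j.rev
    refine Ambiguous.of_reverse (by omega) (Ambiguous.of_flipCols ?_)
    convert h using 1
    rw [Fin.val_rev]
    omega

theorem ambiguous_top_row_of_small {n v : ℕ} (hn : n % 2 = 1) (j : Fin n) (hv : 1 ≤ v)
    (hvj : v < j) (hparity : (j + v) % 2 = 1) : Ambiguous ((0 : Fin 3), j) v := by
  obtain ⟨m, hm⟩ : ∃ m, m + v = j + 1 := ⟨j + 1 - v, by omega⟩
  have hj := j.2
  refine ⟨_, _, hookColumns_isNumbrix (m := m) hn (by omega) (by omega),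
    hookRows_isNumbrix (m := m) hn (by omega) (by omega), ?_, ?_, fun heq => ?_⟩
  · simp only [hookColumns, hookPath, Fin.val_zero]
    split_ifs <;> omega
  · simp only [hookRows, hookPath, Fin.val_zero]
    split_ifs <;> omega
  · have h := congrFun heq (1, ⟨m - 1, by omega⟩)
    simp only [hookColumns, hookRows, Fin.val_one] at h
    split_ifs at h <;> omega

/-- On a `3 × n` board with `n` odd, the cells coloured like the corners carry the odd values. -/
theorem IsNumbrix.parity_of_odd {n : ℕ} (hn : n % 2 = 1) {f : Fin 3 × Fin n → ℕ}
    (hf : IsNumbrix f) (c : Fin 3 × Fin n) : ((c.1 : ℕ) + c.2 + f c) % 2 = 1 := by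
  have hconst : ∀ a b : Fin 3 × Fin n,
      ((a.1 : ℕ) + a.2 + f a) % 2 = ((b.1 : ℕ) + b.2 + f b) % 2 := by
    intro a b
    rcases le_total (f a) (f b) with h | h
    · exact (hf.dist_le_and_parity (Nat.add_sub_of_le h).symm).2.2.2.2
    · exact (hf.dist_le_and_parity (Nat.add_sub_of_le h).symm).2.2.2.2.symm
  by_contra hc
  have heven : ∀ a : Fin 3 × Fin n, (-1 : ℤ) ^ f a = (-1) ^ (a.1 : ℕ) * (-1) ^ (a.2 : ℕ) := by
    intro a
    have := hconst a c
    rw [← pow_add]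
    exact neg_one_pow_congr (by grind)
  have hcells : ∑ a : Fin 3 × Fin n, (-1 : ℤ) ^ f a = 1 := by
    rw [Finset.sum_congr rfl fun a _ => heven a, Fintype.sum_prod_type]
    simp only [← Finset.mul_sum, ← Finset.sum_mul, Fin.sum_univ_eq_sum_range (fun i => (-1 : ℤ) ^ i)]
    rw [neg_one_geom_sum, neg_one_geom_sum]
    simp [Nat.even_iff, hn]
  have hvalues : ∑ a : Fin 3 × Fin n, (-1 : ℤ) ^ f a = ∑ k ∈ Finset.range (3 * n), (-1) ^ (k + 1) := by
    refine Finset.sum_bij (fun a _ => f a - 1) (fun a _ => ?_) (fun a _ b _ hab => ?_)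
      (fun k hk => ?_) (fun a _ => ?_)
    · have := hf.1 a
      exact Finset.mem_range.2 (by omega)
    · have ha := hf.1 a
      have hb := hf.1 b
      exact hf.2.1 (by omega)
    · have := Finset.mem_range.1 hk
      obtain ⟨a, ha⟩ := hf.exists_eq (k := k + 1) (by omega) (by omega)
      exact ⟨a, Finset.mem_univ _, by omega⟩
    · rw [Nat.sub_add_cancel (hf.1 a).1]
  simp only [pow_succ, ← Finset.sum_mul, neg_one_geom_sum, Nat.even_iff] at hvalues
  rw [hcells, if_neg (by omega)] at hvalues
  norm_num at hvalues

theorem ambiguous_top_row_of_odd {n v : ℕ} (hn : 3 ≤ n) (hodd : n % 2 = 1) (j : Fin n)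
    (hv : 1 ≤ v) (hv' : v ≤ 3 * n) (hparity : (j + v) % 2 = 1) :
    Ambiguous ((0 : Fin 3), j) v := by
  have hj := j.2
  have hlower : ∀ u, 1 ≤ u → u ≤ j + 1 + 2 * n → (j + u) % 2 = 1 →
      Ambiguous ((0 : Fin 3), j) u := by
    intro u hu hu' hju
    rcases lt_or_ge u j with h | h
    · exact ambiguous_top_row_of_small hodd j hu h hju
    · obtain ⟨w, rfl⟩ : ∃ w, u = j + 1 + 2 * w := ⟨(u - (j + 1)) / 2, by omega⟩
      exact ambiguous_top_row_of_le hn (by omega) j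
  rcases le_or_gt v (j + 1 + 2 * n) with h | h
  · exact hlower v hv h hparity
  · exact Ambiguous.of_reverse hv' (hlower _ (by omega) (by omega) (by omega))

theorem IsNumbrix.ambiguous {n : ℕ} (hn : 3 ≤ n) {f : Fin 3 × Fin n → ℕ} (hf : IsNumbrix f)
    (c : Fin 3 × Fin n) : Ambiguous c (f c) := by
  have hc := hf.1 c
  rcases Nat.mod_two_eq_zero_or_one n with heven | hodd
  · exact ambiguous_of_even heven (by omega) c hc.1 hc.2
  have hparity := hf.parity_of_odd hodd c
  obtain ⟨i, j⟩ := c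
  fin_cases i
  · exact ambiguous_top_row_of_odd hn hodd j hc.1 hc.2 (by simpa using hparity)
  · exact ambiguous_of_middle_row (by omega) hf j
  · refine Ambiguous.of_flipRows ?_
    refine ambiguous_top_row_of_odd hn hodd j hc.1 hc.2 ?_
    simp only at hparity ⊢
    omega

/-- The rows from top to bottom, traversed alternately to the right and to the left. -/
def rowSnake (n r s : ℕ) : ℕ :=
  if r = 0 then s + 1 else if r = 1 then 2 * n - s else 2 * n + 1 + s

theorem rowSnake_isNumbrix {n : ℕ} (hn : 0 < n) :
    IsNumbrix (fun c : Fin 3 × Fin n => rowSnake n c.1 c.2) := by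
  refine IsNumbrix.of_step (F := rowSnake n) (fun r s hr hs => ?_) ⟨0, 0, ?_⟩
    fun r s hr hs hlt => ?_
  · grind [rowSnake]
  · grind [rowSnake]
  · have hcases : (r ≠ 1 ∧ s + 1 < n) ∨ (r = 0 ∧ s + 1 = n) ∨ (r = 1 ∧ s = 0) ∨
        (r = 1 ∧ 0 < s) := by
      grind [rowSnake]
    rcases hcases with h | h | h | h
    · exact ⟨r, s + 1, by grind [rowSnake]⟩
    · exact ⟨1, s, by grind [rowSnake]⟩
    · exact ⟨2, s, by grind [rowSnake]⟩
    · exact ⟨1, s - 1, by grind [rowSnake]⟩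

/-- A solution that runs straight from `(i, a)` to `(i, b)` is determined in between. -/
theorem IsNumbrix.straight_right {m n : ℕ} {f : Fin m × Fin n → ℕ} (hf : IsNumbrix f) {i : Fin m}
    {a b : Fin n} (hab : f (i, b) + a = f (i, a) + b) (j : Fin n) (haj : a ≤ j) (hjb : j ≤ b) :
    f (i, j) + a = f (i, a) + j := by
  have ha := hf.1 (i, a)
  have hb := hf.1 (i, b)
  rw [Fin.le_def] at haj hjb
  obtain ⟨c, hc⟩ := hf.exists_eq (k := f (i, a) + (j - a)) (by omega) (by omega)
  have h1 := hf.dist_le_and_parity hc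
  have h2 := hf.dist_le_and_parity (a := c) (b := (i, b)) (d := b - j) (by omega)
  dsimp only at h1 h2
  obtain rfl : c = (i, j) := by
    rw [Prod.ext_iff, Fin.ext_iff, Fin.ext_iff]
    dsimp only
    omega
  omega

theorem IsNumbrix.dist_le {m n : ℕ} {f : Fin m × Fin n → ℕ} (hf : IsNumbrix f)
    {a b : Fin m × Fin n} (hab : f a ≤ f b) :
    (a.1 : ℕ) + a.2 + f a ≤ b.1 + b.2 + f b ∧ (b.1 : ℕ) + b.2 + f a ≤ a.1 + a.2 + f b ∧
      (a.1 : ℕ) + b.2 + f a ≤ b.1 + a.2 + f b ∧ (b.1 : ℕ) + a.2 + f a ≤ a.1 + b.2 + f b := by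
  have := hf.dist_le_and_parity (Nat.add_sub_of_le hab).symm
  omega

theorem eq_rowSnake {n : ℕ} (hn : 3 ≤ n) {f : Fin 3 × Fin n → ℕ} (hf : IsNumbrix f)
    (h00 : f (0, ⟨0, by omega⟩) = 1) (h10 : f (1, ⟨0, by omega⟩) = 2 * n) :
    f = fun c => rowSnake n c.1 c.2 := by
  set a : Fin n := ⟨0, by omega⟩ with ha
  set b : Fin n := ⟨n - 1, by omega⟩ with hb
  have ha' : (a : ℕ) = 0 := rfl
  have hb' : (b : ℕ) = n - 1 := rfl
  have hab : a ≠ b := by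
    rw [Ne, Fin.ext_iff]
    omega
  have hrange := hf.1
  have hdist : ∀ c d : Fin 3 × Fin n, f c ≤ f d → _ := fun c d => hf.dist_le
  have h2b : f (2, b) = 3 * n := by
    have h0 := hdist (0, a) (2, b)
    have h1 := hdist (2, b) (1, a)
    have h2 := hdist (1, a) (2, b)
    have h3 := hrange (2, b)
    simp only [h00, h10, ha', hb', Fin.val_zero, Fin.val_one, Fin.val_two] at h0 h1 h2
    omega
  have h2a_ne : f (2, a) ≠ 3 * n := fun h => by
    have := hf.2.1 (h.trans h2b.symm)
    simp [hab] at this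
  have h2a_ne' : f (2, a) ≠ 1 := fun h => by
    have := hf.2.1 (h.trans h00.symm)
    simp at this
  have hcorner : f (2, a) + 1 = 2 * n ∨ f (2, a) = 2 * n + 1 := by
    have h := hrange (2, a)
    obtain ⟨p, hp⟩ := hf.exists_eq (k := f (2, a) - 1) (by omega) (by omega)
    obtain ⟨q, hq⟩ := hf.exists_eq (k := f (2, a) + 1) (by omega) (by omega)
    have hp' := hf.2.2 p (2, a) (by omega)
    have hq' := hf.2.2 (2, a) q (by omega)
    have hpq : p ≠ q := by
      rintro rfl
      omega
    simp only [Adj, Fin.ext_iff, ha', Fin.val_two] at hp' hq'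
    have hcases : ((p.1 : ℕ) = 1 ∧ (p.2 : ℕ) = 0) ∨ ((q.1 : ℕ) = 1 ∧ (q.2 : ℕ) = 0) := by
      rw [Ne, Prod.ext_iff, Fin.ext_iff, Fin.ext_iff] at hpq
      omega
    rcases hcases with ⟨h1, h2⟩ | ⟨h1, h2⟩
    · obtain rfl : p = (1, a) := Prod.ext (Fin.ext h1) (Fin.ext h2)
      omega
    · obtain rfl : q = (1, a) := Prod.ext (Fin.ext h1) (Fin.ext h2)
      omega
  have h0b_ne : f (0, b) ≠ 3 * n := fun h => by
    have := hf.2.1 (h.trans h2b.symm)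
    simp at this
  have h2a : f (2, a) = 2 * n + 1 := by
    have h0 := hdist (0, a) (0, b)
    have h1 := hdist (0, b) (2, a)
    have h2 := hdist (2, a) (0, b)
    have h3 := hdist (0, b) (1, a)
    have h4 := hdist (1, a) (0, b)
    have h5 := hrange (0, b)
    simp only [h00, h10, ha', hb', Fin.val_zero, Fin.val_one, Fin.val_two] at h0 h1 h2 h3 h4
    omega
  have h0b : f (0, b) = n := by
    have h0 := hdist (0, a) (0, b)
    have h1 := hdist (0, b) (1, a)
    have h2 := hdist (2, a) (0, b)
    have h5 := hrange (0, b)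
    simp only [h00, h10, h2a, ha', hb', Fin.val_zero, Fin.val_one, Fin.val_two] at h0 h1 h2
    omega
  have h1b : f (1, b) = n + 1 := by
    have h0 := hdist (0, a) (1, b)
    have h1 := hdist (1, b) (1, a)
    have h2 := hdist (2, a) (1, b)
    have h5 := hrange (1, b)
    simp only [h00, h10, h2a, ha', hb', Fin.val_zero, Fin.val_one, Fin.val_two] at h0 h1 h2
    omega
  have hmin : ∀ j : Fin n, a ≤ j := fun j => Fin.le_def.2 (by omega)
  have hmax : ∀ j : Fin n, j ≤ b := fun j => Fin.le_def.2 (by omega)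
  have hrev : b = a.rev := Fin.ext (by rw [Fin.val_rev])
  have hrev' : a = b.rev := by rw [hrev, Fin.rev_rev]
  funext ⟨i, j⟩
  have hj := j.2
  fin_cases i
  · have := hf.straight_right (i := 0) (a := a) (b := b) (by omega) j (hmin j) (hmax j)
    simp [rowSnake]
    omega
  · have := hf.flipCols.straight_right (i := 1) (a := a) (b := b)
      (by simp only [← hrev, ← hrev']; omega) j.rev (hmin _) (hmax _)
    simp only [Fin.rev_rev, ← hrev, Fin.val_rev] at this
    simp [rowSnake]
    omega
  · have := hf.straight_right (i := 2) (a := a) (b := b) (by omega) j (hmin j) (hmax j)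
    simp [rowSnake]
    omega

theorem three_by_n_min_is_two (n : ℕ) (hn : 3 ≤ n) :
    (∀ (c : Fin 3 × Fin n) (v : ℕ),
      (∃ f : Fin 3 × Fin n → ℕ, IsNumbrix f ∧ f c = v) →
      ∃ g h : Fin 3 × Fin n → ℕ,
        IsNumbrix g ∧ IsNumbrix h ∧ g c = v ∧ h c = v ∧ g ≠ h) ∧
    (∃ S : Finset ((Fin 3 × Fin n) × ℕ),
      S.card = 2 ∧
      ∃! f : Fin 3 × Fin n → ℕ, IsNumbrix f ∧ ∀ p ∈ S, f p.1 = p.2) := by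
  refine ⟨?_, {((0, ⟨0, by omega⟩), 1), ((1, ⟨0, by omega⟩), 2 * n)}, ?_,
    fun c => rowSnake n c.1 c.2, ⟨rowSnake_isNumbrix (by omega), ?_⟩, ?_⟩
  · rintro c v ⟨f, hf, rfl⟩
    exact hf.ambiguous hn c
  · rw [Finset.card_pair]
    simp
  · simp [rowSnake]
  · rintro f ⟨hf, hS⟩
    simp only [Finset.mem_insert, Finset.mem_singleton, forall_eq_or_imp, forall_eq] at hS
    exact eq_rowSnake hn hf hS.1 hS.2
end
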